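/- arXiv:1409.1385 — 6 statements merged into one kernel-verified Lean document; each statement's English description precedes it below -/
import Mathlib

section
/- Let p and q be prime numbers and n, m ≥ 1 integers. If there is an isomorphism of topological groups between the additive groups (ℚ_p^n, +) and (ℚ_q^m, +), then p = q and n = m. -/
/-- A nontrivial continuous additive map from a `ℚ_[p]`-vector space to a power of `ℚ_[q]`
forces `p = q`. -/
theorem padic_prime_eq_of_continuous_addMonoidHom {p q : ℕ} [Fact p.Prime] [Fact q.Prime]
    {V ι : Type*} [AddCommGroup V] [Module ℚ_[p] V] [TopologicalSpace V]
    [ContinuousSMul ℚ_[p] V] (f : V →+ (ι → ℚ_[q])) (hf : Continuous f) (hne : f ≠ 0) :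
    p = q := by
  obtain ⟨x, hx⟩ := DFunLike.ne_iff.mp hne
  obtain ⟨i, hi⟩ := Function.ne_iff.mp hx
  by_contra hpq
  have hp : ‖(p : ℚ_[q])‖ = 1 := by
    rw [Padic.norm_natCast_eq_one_iff]
    exact (Nat.coprime_primes Fact.out Fact.out).mpr (Ne.symm hpq)
  have hpow : Filter.Tendsto (fun k : ℕ => (p : ℚ_[p]) ^ k) Filter.atTop (nhds 0) :=
    tendsto_pow_atTop_nhds_zero_of_norm_lt_one Padic.norm_p_lt_one
  have hsmul : Filter.Tendsto (fun k : ℕ => f ((p : ℚ_[p]) ^ k • x) i) Filter.atTop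
      (nhds 0) := by
    have hc : Continuous fun t : ℚ_[p] => f (t • x) i := by fun_prop
    simpa [Function.comp_def] using (hc.tendsto 0).comp hpow
  have hconst (k : ℕ) : ‖f ((p : ℚ_[p]) ^ k • x) i‖ = ‖f x i‖ := by
    rw [← Nat.cast_pow, Nat.cast_smul_eq_nsmul, map_nsmul]
    simp [hp]
  have hlim := hsmul.norm
  simp only [hconst, norm_zero] at hlim
  exact hi (norm_eq_zero.mp (tendsto_nhds_unique tendsto_const_nhds hlim))

/-- Continuous additive maps between topological `ℚ_[p]`-vector spaces are `ℚ_[p]`-linear. -/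
theorem map_padic_smul {p : ℕ} [Fact p.Prime] {V W : Type*}
    [AddCommGroup V] [Module ℚ_[p] V] [TopologicalSpace V] [ContinuousSMul ℚ_[p] V]
    [AddCommGroup W] [Module ℚ_[p] W] [TopologicalSpace W] [ContinuousSMul ℚ_[p] W] [T2Space W]
    (f : V →+ W) (hf : Continuous f) (c : ℚ_[p]) (x : V) : f (c • x) = c • f x := by
  have h : (fun t : ℚ_[p] => f (t • x)) = fun t => t • f x :=
    (Padic.denseRange_ratCast p).equalizer (by fun_prop) (by fun_prop)
      (funext fun r => map_ratCast_smul f ℚ_[p] ℚ_[p] r x)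
  exact congrFun h c

/-- If the additive topological groups `ℚ_p^n` and `ℚ_q^m` are isomorphic as
topological groups (for primes `p`, `q` and `n, m ≥ 1`), then `p = q` and `n = m`. -/
theorem padic_pow_addEquiv_eq (p q : ℕ) [Fact p.Prime] [Fact q.Prime]
    (n m : ℕ) (hn : 1 ≤ n) (hm : 1 ≤ m)
    (h : ∃ e : (Fin n → ℚ_[p]) ≃+ (Fin m → ℚ_[q]), Continuous e ∧ Continuous e.symm) :
    p = q ∧ n = m := by
  obtain ⟨e, he, -⟩ := h
  have : NeZero n := ⟨by omega⟩
  have hne : (e : (Fin n → ℚ_[p]) →+ (Fin m → ℚ_[q])) ≠ 0 := fun h0 =>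
    one_ne_zero (e.map_eq_zero_iff.mp (DFunLike.congr_fun h0 1))
  obtain rfl := padic_prime_eq_of_continuous_addMonoidHom (p := p) _ he hne
  let l : (Fin n → ℚ_[p]) ≃ₗ[ℚ_[p]] (Fin m → ℚ_[p]) :=
    { e with map_smul' := map_padic_smul e.toAddMonoidHom he }
  exact ⟨rfl, by simpa using l.finrank_eq⟩
end

section
/- Let p and q be prime numbers and n, m ≥ 1 integers. If there is an isomorphism of abstract groups between the additive groups ℤ × ℤ_p^n and ℤ × ℤ_q^m, then p = q and n = m. -/
theorem index_range_nsmulAddMonoidHom_eq_natCard {G H : Type*} [AddCommGroup G] [AddCommGroup H]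
    {k : ℕ} (f : G →+ H) (hf : Function.Surjective f) (hker : ∀ x, f x = 0 ↔ ∃ y, k • y = x) :
    (nsmulAddMonoidHom (α := G) k).range.index = Nat.card H := by
  have hrange : (nsmulAddMonoidHom (α := G) k).range = f.ker := by
    ext x
    simp [AddMonoidHom.mem_ker, hker]
  rw [hrange, AddSubgroup.index_ker, AddMonoidHom.range_eq_top.2 hf]
  simp

theorem AddEquiv.index_range_nsmulAddMonoidHom_eq {G H : Type*} [AddCommGroup G] [AddCommGroup H]
    (e : G ≃+ H) (k : ℕ) :
    (nsmulAddMonoidHom (α := G) k).range.index = (nsmulAddMonoidHom (α := H) k).range.index := by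
  rw [← AddSubgroup.index_comap_of_surjective _ (f := e.toAddMonoidHom) e.surjective]
  congr 1
  ext x
  simp only [AddMonoidHom.mem_range, AddSubgroup.mem_comap, nsmulAddMonoidHom_apply]
  constructor
  · rintro ⟨y, rfl⟩
    exact ⟨e y, by simp⟩
  · rintro ⟨y, hy⟩
    exact ⟨e.symm y, e.injective (by simpa using hy)⟩

theorem PadicInt.toZMod_eq_zero_iff_dvd {p : ℕ} [Fact p.Prime] (x : ℤ_[p]) :
    PadicInt.toZMod x = 0 ↔ (p : ℤ_[p]) ∣ x := by
  rw [← RingHom.mem_ker, PadicInt.ker_toZMod, PadicInt.maximalIdeal_eq_span_p,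
    Ideal.mem_span_singleton]

theorem index_range_nsmul_int_prod_padicInt_pow (p : ℕ) [Fact p.Prime] (n : ℕ) :
    (nsmulAddMonoidHom (α := ℤ × (Fin n → ℤ_[p])) p).range.index = p ^ (n + 1) := by
  rw [index_range_nsmulAddMonoidHom_eq_natCard
    ((Int.castAddHom (ZMod p)).prodMap
      ((PadicInt.toZMod (p := p)).toAddMonoidHom.compLeft (Fin n)))]
  · simp [pow_succ']
  · rw [AddMonoidHom.coe_prodMap]
    exact Function.Surjective.prodMap ZMod.intCast_surjective
      (ZMod.ringHom_surjective (PadicInt.toZMod (p := p))).comp_left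
  · rintro ⟨a, v⟩
    have hv : (PadicInt.toZMod (p := p)).toAddMonoidHom.compLeft (Fin n) v = 0 ↔
        ∀ i, (p : ℤ_[p]) ∣ v i := by
      simp only [← PadicInt.toZMod_eq_zero_iff_dvd]
      exact funext_iff
    simp only [AddMonoidHom.prodMap_def, AddMonoidHom.prod_apply, AddMonoidHom.comp_apply,
      AddMonoidHom.coe_fst, AddMonoidHom.coe_snd, Prod.mk_eq_zero, hv, Int.coe_castAddHom,
      ZMod.intCast_zmod_eq_zero_iff_dvd]
    constructor
    · rintro ⟨⟨b, rfl⟩, h⟩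
      choose w hw using h
      exact ⟨(b, w), by ext <;> simp [hw]⟩
    · rintro ⟨⟨b, w⟩, h⟩
      obtain ⟨rfl, rfl⟩ := Prod.mk.inj h
      exact ⟨⟨b, by simp⟩, fun i => ⟨w i, by simp⟩⟩

theorem index_range_nsmul_int_prod_padicInt_pow_of_ne (p q : ℕ) [Fact p.Prime] [Fact q.Prime]
    (hpq : p ≠ q) (m : ℕ) :
    (nsmulAddMonoidHom (α := ℤ × (Fin m → ℤ_[q])) p).range.index = p := by
  have hunit : IsUnit (p : ℤ_[q]) := by
    rw [PadicInt.isUnit_iff, PadicInt.norm_natCast_eq_one_iff]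
    exact (Nat.coprime_primes Fact.out Fact.out).2 hpq.symm
  rw [index_range_nsmulAddMonoidHom_eq_natCard
    ((Int.castAddHom (ZMod p)).comp (AddMonoidHom.fst ℤ (Fin m → ℤ_[q])))]
  · simp
  · exact ZMod.intCast_surjective.comp Prod.fst_surjective
  · rintro ⟨a, v⟩
    simp only [AddMonoidHom.comp_apply, AddMonoidHom.coe_fst, Int.coe_castAddHom,
      ZMod.intCast_zmod_eq_zero_iff_dvd]
    constructor
    · rintro ⟨b, rfl⟩
      choose w hw using fun i => hunit.dvd (a := v i)
      exact ⟨(b, w), by ext <;> simp [hw]⟩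
    · rintro ⟨⟨b, w⟩, h⟩
      exact ⟨b, by simpa using (congrArg Prod.fst h).symm⟩

/-- If the abstract additive groups `ℤ × ℤ_p^n` and `ℤ × ℤ_q^m` are isomorphic
(for primes `p`, `q` and `n, m ≥ 1`), then `p = q` and `n = m`. -/
theorem int_prod_padicInt_pow_addEquiv_eq (p q : ℕ) [Fact p.Prime] [Fact q.Prime]
    (n m : ℕ) (hn : 1 ≤ n) (hm : 1 ≤ m)
    (h : Nonempty ((ℤ × (Fin n → ℤ_[p])) ≃+ (ℤ × (Fin m → ℤ_[q])))) :
    p = q ∧ n = m := by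
  obtain ⟨e⟩ := h
  have hp : 1 < p := (Fact.out : p.Prime).one_lt
  have hindex := e.index_range_nsmulAddMonoidHom_eq p
  rw [index_range_nsmul_int_prod_padicInt_pow] at hindex
  obtain rfl : p = q := by
    by_contra hpq
    rw [index_range_nsmul_int_prod_padicInt_pow_of_ne p q hpq] at hindex
    have := Nat.pow_right_injective hp (hindex.trans (pow_one p).symm)
    omega
  rw [index_range_nsmul_int_prod_padicInt_pow] at hindex
  exact ⟨rfl, Nat.succ_injective (Nat.pow_right_injective hp hindex)⟩
end

section
/- Let p be a prime, let L be a finite field extension of ℚ_p, and let N ≥ 1. If v ∈ GL_N(L) is divisible, i.e. for every integer m ≥ 1 there exists w ∈ GL_N(L) with w^m = v, then v is unipotent: (v − 1)^N = 0 as an N × N matrix over L. -/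
open Polynomial

section NormedExtension

variable {p : ℕ} [Fact p.Prime] {Ω : Type*} [NormedField Ω] [NormedAlgebra ℚ_[p] Ω]
  [Algebra.IsAlgebraic ℚ_[p] Ω]

/-- The norm of a nonzero element of degree `d` over `ℚ_[p]` has `d`-th power in `p ^ ℤ`. -/
lemma exists_norm_pow_natDegree_minpoly_eq_zpow {x : Ω} (hx : x ≠ 0) :
    ∃ n : ℤ, ‖x‖ ^ (minpoly ℚ_[p] x).natDegree = (p : ℝ) ^ n := by
  have hint : IsIntegral ℚ_[p] x := (Algebra.IsAlgebraic.isAlgebraic x).isIntegral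
  refine ⟨-((minpoly ℚ_[p] x).coeff 0).valuation, ?_⟩
  rw [← Padic.norm_eq_zpow_neg_valuation (minpoly.coeff_zero_ne_zero hint hx),
    NormedAlgebra.norm_eq_spectralNorm ℚ_[p],
    spectralNorm.spectralNorm_eq_norm_coeff_zero_rpow, one_div,
    Real.rpow_inv_natCast_pow (norm_nonneg _) (minpoly.natDegree_pos hint).ne']

/-- An element having roots of all orders of bounded degree over `ℚ_[p]` has norm one. -/
lemma norm_eq_one_of_forall_exists_pow_eq {x : Ω} (hx : x ≠ 0) (D : ℕ)
    (h : ∀ m : ℕ, 1 ≤ m → ∃ y : Ω, (minpoly ℚ_[p] y).natDegree ≤ D ∧ y ^ m = x) :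
    ‖x‖ = 1 := by
  have hp : (1 : ℝ) < p := by exact_mod_cast (Fact.out : p.Prime).one_lt
  have key : ∀ y : Ω, y ≠ 0 → (minpoly ℚ_[p] y).natDegree ≤ D →
      ∃ n : ℤ, ‖y‖ ^ D.factorial = (p : ℝ) ^ n := by
    intro y hy hD
    obtain ⟨n, hn⟩ := exists_norm_pow_natDegree_minpoly_eq_zpow (p := p) hy
    obtain ⟨c, hc⟩ := Nat.dvd_factorial (minpoly.natDegree_pos
      (Algebra.IsAlgebraic.isAlgebraic (R := ℚ_[p]) y).isIntegral) hD
    exact ⟨n * c, by rw [hc, pow_mul, hn, zpow_mul, zpow_natCast]⟩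
  obtain ⟨a, ha⟩ : ∃ a : ℤ, ‖x‖ ^ D.factorial = (p : ℝ) ^ a := by
    obtain ⟨y, hy, hyx⟩ := h 1 le_rfl
    rw [pow_one] at hyx
    exact key x hx (hyx ▸ hy)
  obtain ⟨y, hy, hyx⟩ := h (a.natAbs + 1) (by omega)
  obtain ⟨b, hb⟩ := key y (by rintro rfl; exact hx (by rw [← hyx, zero_pow (by omega)])) hy
  have hab : a = b * (a.natAbs + 1 : ℕ) := by
    apply zpow_right_injective₀ (by linarith) hp.ne'
    change (p : ℝ) ^ a = (p : ℝ) ^ (b * (a.natAbs + 1 : ℕ))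
    rw [← ha, ← hyx, norm_pow, ← pow_mul, mul_comm, pow_mul, hb, zpow_mul, zpow_natCast]
  have ha0 : a = 0 := by
    apply Int.eq_zero_of_abs_lt_dvd (m := ((a.natAbs + 1 : ℕ) : ℤ)) ⟨b, by rw [mul_comm]; exact hab⟩
    push_cast
    omega
  rw [ha0, zpow_zero] at ha
  exact (pow_eq_one_iff_of_nonneg (norm_nonneg _) D.factorial_ne_zero).1 ha

/-- An algebraic element of norm at most one is a root of a monic polynomial over `ℤ_[p]` of
the same degree as its minimal polynomial. -/
lemma exists_monic_padicInt_of_norm_le_one {y : Ω} (hy : ‖y‖ ≤ 1) :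
    ∃ q : ℤ_[p][X], q.Monic ∧ q.natDegree = (minpoly ℚ_[p] y).natDegree ∧
      q.eval₂ ((algebraMap ℚ_[p] Ω).comp PadicInt.Coe.ringHom) y = 0 := by
  have hmonic := minpoly.monic (Algebra.IsAlgebraic.isAlgebraic (R := ℚ_[p]) y).isIntegral
  rw [NormedAlgebra.norm_eq_spectralNorm ℚ_[p], spectralNorm, spectralValue_le_one_iff hmonic]
    at hy
  obtain ⟨q, hq, hdeg, hqm⟩ := lifts_and_natDegree_eq_and_monic
    (f := PadicInt.Coe.ringHom) (p := minpoly ℚ_[p] y)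
    ((lifts_iff_coeff_lifts _).2 fun n ↦ ⟨⟨_, hy n⟩, rfl⟩) hmonic
  refine ⟨q, hqm, hdeg, ?_⟩
  rw [← eval₂_map, hq]
  exact minpoly.aeval ℚ_[p] y

variable [IsUltrametricDist Ω]

/-- A power of an element of norm one, with exponent depending only on the degree and on `k`,
is congruent to `1` modulo `p ^ k`. -/
lemma norm_pow_factorial_sub_one_le {y : Ω} (hy : ‖y‖ = 1) {D : ℕ}
    (hD : (minpoly ℚ_[p] y).natDegree ≤ D) (k : ℕ) :
    ‖y ^ ((p ^ k) ^ D).factorial - 1‖ ≤ (p : ℝ) ^ (-k : ℤ) := by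
  obtain ⟨q, hqm, hdeg, hq⟩ := exists_monic_padicInt_of_norm_le_one (p := p) hy.le
  have hdpos : 0 < q.natDegree := hdeg ▸ minpoly.natDegree_pos
    (Algebra.IsAlgebraic.isAlgebraic (R := ℚ_[p]) y).isIntegral
  have hq1 : q ≠ 1 := by rintro rfl; simp at hdpos
  set φ : ℤ_[p] →+* Ω := (algebraMap ℚ_[p] Ω).comp PadicInt.Coe.ringHom with hφ
  have hφn : ∀ a, ‖φ a‖ = ‖a‖ := fun a ↦ by
    rw [hφ, RingHom.comp_apply, norm_algebraMap']
    rfl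
  have hexp : ∀ n : ℕ, y ^ n = ∑ i ∈ Finset.range D, φ ((X ^ n %ₘ q).coeff i) * y ^ i := by
    intro n
    rw [← eval₂_eq_sum_range' φ
      ((natDegree_modByMonic_lt (X ^ n) hqm hq1).trans_le (hdeg.trans_le hD)) y]
    have := congrArg (eval₂ φ y) (modByMonic_add_div (X ^ n : ℤ_[p][X]) q)
    rw [eval₂_add, eval₂_mul, hq, zero_mul, add_zero, eval₂_X_pow] at this
    exact this.symm
  have : NeZero (p ^ k) := ⟨pow_ne_zero _ (Fact.out : p.Prime).ne_zero⟩
  obtain ⟨i, j, hij, hg⟩ : ∃ i j : Fin ((p ^ k) ^ D + 1), i < j ∧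
      ∀ l : Fin D, PadicInt.toZModPow k ((X ^ (i : ℕ) %ₘ q).coeff l) =
        PadicInt.toZModPow k ((X ^ (j : ℕ) %ₘ q).coeff l) := by
    obtain ⟨i, j, hne, h⟩ := Fintype.exists_ne_map_eq_of_card_lt
      (fun (n : Fin ((p ^ k) ^ D + 1)) (l : Fin D) ↦
        PadicInt.toZModPow (p := p) k ((X ^ (n : ℕ) %ₘ q).coeff l)) (by simp [ZMod.card])
    rcases hne.lt_or_gt with hlt | hlt
    · exact ⟨i, j, hlt, fun l ↦ congrFun h l⟩
    · exact ⟨j, i, hlt, fun l ↦ (congrFun h l).symm⟩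
  have hdiff : ‖y ^ (j : ℕ) - y ^ (i : ℕ)‖ ≤ (p : ℝ) ^ (-k : ℤ) := by
    rw [hexp j, hexp i, ← Finset.sum_sub_distrib]
    refine IsUltrametricDist.norm_sum_le_of_forall_le_of_nonneg (by positivity) fun l hl ↦ ?_
    rw [← sub_mul, ← map_sub, norm_mul, norm_pow, hy, one_pow, mul_one, hφn,
      PadicInt.norm_le_pow_iff_mem_span_pow, ← PadicInt.ker_toZModPow, RingHom.mem_ker, map_sub,
      sub_eq_zero]
    exact (hg ⟨l, Finset.mem_range.1 hl⟩).symm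
  have hij' : (i : ℕ) < j := hij
  obtain ⟨t, ht⟩ : (j - i : ℕ) ∣ ((p ^ k) ^ D).factorial :=
    Nat.dvd_factorial (by omega) (by have := j.2; omega)
  have hbase : ‖y ^ (j - i : ℕ) - 1‖ ≤ (p : ℝ) ^ (-k : ℤ) := by
    rwa [← Nat.add_sub_of_le hij'.le, pow_add, ← mul_sub_one, norm_mul, norm_pow, hy, one_pow,
      one_mul] at hdiff
  rw [ht, pow_mul, ← geom_sum_mul, norm_mul]
  refine (mul_le_of_le_one_left (norm_nonneg _) ?_).trans hbase
  exact IsUltrametricDist.norm_sum_le_of_forall_le_of_nonneg zero_le_one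
    fun l _ ↦ by rw [norm_pow, norm_pow, hy, one_pow, one_pow]

/-- A nonzero element having roots of all orders of bounded degree over `ℚ_[p]` equals `1`. -/
lemma eq_one_of_forall_exists_pow_eq_of_normedField {x : Ω} (hx : x ≠ 0) (D : ℕ)
    (h : ∀ m : ℕ, 1 ≤ m → ∃ y : Ω, (minpoly ℚ_[p] y).natDegree ≤ D ∧ y ^ m = x) : x = 1 := by
  have hp : (1 : ℝ) < p := by exact_mod_cast (Fact.out : p.Prime).one_lt
  have hx1 := norm_eq_one_of_forall_exists_pow_eq hx D h
  have hle : ∀ k : ℕ, ‖x - 1‖ ≤ ((p : ℝ)⁻¹) ^ k := by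
    intro k
    obtain ⟨y, hy, hyx⟩ := h _ (Nat.factorial_pos ((p ^ k) ^ D))
    have hy1 : ‖y‖ = 1 := by
      rw [← hyx, norm_pow] at hx1
      exact (pow_eq_one_iff_of_nonneg (norm_nonneg _) (Nat.factorial_ne_zero _)).1 hx1
    rw [← hyx, inv_pow, ← zpow_natCast (p : ℝ) k, ← zpow_neg]
    exact norm_pow_factorial_sub_one_le hy1 hy k
  have := ge_of_tendsto' (tendsto_pow_atTop_nhds_zero_of_lt_one (by positivity)
    (inv_lt_one_of_one_lt₀ hp)) hle
  exact sub_eq_zero.1 (norm_le_zero_iff.1 this)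

end NormedExtension

/-- In an algebraic extension of `ℚ_[p]`, a nonzero element having roots of all orders of bounded
degree equals `1`. -/
lemma eq_one_of_forall_exists_pow_eq (p : ℕ) [Fact p.Prime] {Ω : Type*} [Field Ω]
    [Algebra ℚ_[p] Ω] [Algebra.IsAlgebraic ℚ_[p] Ω] {x : Ω} (hx : x ≠ 0) (D : ℕ)
    (h : ∀ m : ℕ, 1 ≤ m → ∃ y : Ω, (minpoly ℚ_[p] y).natDegree ≤ D ∧ y ^ m = x) : x = 1 :=
  letI := spectralNorm.normedField ℚ_[p] Ω
  letI := spectralNorm.normedAlgebra ℚ_[p] Ω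
  haveI : IsUltrametricDist Ω :=
    IsUltrametricDist.isUltrametricDist_of_isNonarchimedean_norm
      (isNonarchimedean_spectralNorm (K := ℚ_[p]) (L := Ω))
  eq_one_of_forall_exists_pow_eq_of_normedField (p := p) hx D h

/-- The degree over `K` of an element `x` is at most `[L : K]` times its degree over `L`. -/
lemma natDegree_minpoly_le_finrank_mul (K L : Type*) {Ω : Type*} [Field K] [Field L] [Field Ω]
    [Algebra K L] [Algebra L Ω] [Algebra K Ω] [IsScalarTower K L Ω] [FiniteDimensional K L]
    {x : Ω} (hx : IsIntegral L x) :
    (minpoly K x).natDegree ≤ Module.finrank K L * (minpoly L x).natDegree := by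
  have := IntermediateField.adjoin.finiteDimensional hx
  have : FiniteDimensional K (IntermediateField.adjoin L {x}) := FiniteDimensional.trans K L _
  have : IsScalarTower K (IntermediateField.adjoin L {x}) Ω :=
    IsScalarTower.of_algebraMap_eq fun a ↦ by
      rw [IsScalarTower.algebraMap_apply K L Ω,
        IsScalarTower.algebraMap_apply K L (IntermediateField.adjoin L {x}),
        ← IsScalarTower.algebraMap_apply L (IntermediateField.adjoin L {x}) Ω]
  rw [← IntermediateField.adjoin.finrank hx, Module.finrank_mul_finrank]
  have h := minpoly.natDegree_le (A := K) (IntermediateField.AdjoinSimple.gen L x)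
  rwa [← minpoly.algebraMap_eq (algebraMap (IntermediateField.adjoin L {x}) Ω).injective,
    IntermediateField.AdjoinSimple.algebraMap_gen] at h

/-- A matrix whose only eigenvalue in an algebraically closed extension is `1` is unipotent. -/
lemma Matrix.sub_one_pow_eq_zero_of_spectrum {L Ω n : Type*} [Field L] [Field Ω] [IsAlgClosed Ω]
    [Algebra L Ω] [Fintype n] [DecidableEq n] (A : Matrix n n L)
    (h : ∀ r ∈ spectrum Ω (A.map (algebraMap L Ω)), r = 1) :
    (A - 1) ^ Fintype.card n = 0 := by
  have hchar : A.charpoly = (X - C 1) ^ Fintype.card n := by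
    apply Polynomial.map_injective _ (algebraMap L Ω).injective
    rw [← Matrix.charpoly_map]
    set B := A.map (algebraMap L Ω)
    have hs := IsAlgClosed.splits B.charpoly
    have hroots : B.charpoly.roots = Multiset.replicate (Fintype.card n) 1 := by
      refine Multiset.eq_replicate.2 ⟨?_, fun r hr ↦ h r ?_⟩
      · rw [← hs.natDegree_eq_card_roots, Matrix.charpoly_natDegree_eq_dim]
      · exact Matrix.mem_spectrum_iff_isRoot_charpoly.2 (isRoot_of_mem_roots hr)
    rw [hs.eq_prod_roots_of_monic B.charpoly_monic, hroots]
    simp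
  have := Matrix.aeval_self_charpoly A
  rw [hchar] at this
  simpa using this

/-- Every divisible element of `GL_N(L)`, for `L` a finite extension of `ℚ_p`,
is unipotent. -/
theorem unipotent_of_divisible_padic (p : ℕ) [Fact p.Prime]
    (L : Type*) [Field L] [Algebra ℚ_[p] L] [FiniteDimensional ℚ_[p] L]
    (N : ℕ) (hN : 1 ≤ N) (v : (Matrix (Fin N) (Fin N) L)ˣ)
    (hdiv : ∀ m : ℕ, 1 ≤ m → ∃ w : (Matrix (Fin N) (Fin N) L)ˣ, w ^ m = v) :
    ((v : Matrix (Fin N) (Fin N) L) - 1) ^ N = 0 := by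
  let Ω := AlgebraicClosure L
  have : Algebra.IsAlgebraic ℚ_[p] Ω := Algebra.IsAlgebraic.trans ℚ_[p] L Ω
  let f : Matrix (Fin N) (Fin N) L →+* Matrix (Fin N) (Fin N) Ω := (algebraMap L Ω).mapMatrix
  have hspec : ∀ r ∈ spectrum Ω (f v), r = 1 := by
    intro r hr
    refine eq_one_of_forall_exists_pow_eq p
      (spectrum.ne_zero_of_mem_of_unit (a := Units.map f.toMonoidHom v) hr)
      (Module.finrank ℚ_[p] L * N) fun m hm ↦ ?_
    obtain ⟨w, rfl⟩ := hdiv m hm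
    rw [Units.val_pow_eq_pow_val, map_pow, spectrum.map_pow_of_pos _ hm] at hr
    obtain ⟨s, hs, hsr⟩ := hr
    refine ⟨s, (natDegree_minpoly_le_finrank_mul ℚ_[p] L
      (Algebra.IsAlgebraic.isAlgebraic s).isIntegral).trans (Nat.mul_le_mul_left _ ?_), hsr⟩
    have hroot := Matrix.mem_spectrum_iff_isRoot_charpoly.1 hs
    have hdvd : minpoly L s ∣ (w : Matrix (Fin N) (Fin N) L).charpoly := by
      apply minpoly.dvd
      rw [← eval_map_algebraMap, ← Matrix.charpoly_map]
      exact hroot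
    simpa using natDegree_le_of_dvd hdvd (Matrix.charpoly_monic _).ne_zero
  simpa using Matrix.sub_one_pow_eq_zero_of_spectrum (Ω := Ω) _ hspec
end

section
/- Let p be a prime and n ≥ 1. Every A ∈ GL_n(ℚ_p) can be written as A = B · C where B ∈ GL_n(ℚ_p) is upper triangular (B_{ij} = 0 whenever i > j) and C ∈ GL_n(ℚ_p) lies in GL_n(ℤ_p), i.e. all entries of C and of C⁻¹ have p-adic norm at most 1. In other words, GL_n(ℚ_p) = B(ℚ_p) · GL_n(ℤ_p) where B is the Borel subgroup of upper triangular matrices. -/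
open Matrix in
/-- Right multiplication by an invertible `p`-adic integral matrix clears the entries of row `m`
to the left of the diagonal, without spoiling the rows below it. -/
theorem Padic.exists_unit_matrix_mul_row_eq_zero {p : ℕ} [Fact p.Prime] {n : ℕ}
    (A : Matrix (Fin n) (Fin n) ℚ_[p]) (m : Fin n)
    (hA : ∀ i j : Fin n, m < i → j < i → A i j = 0) :
    ∃ C : (Matrix (Fin n) (Fin n) ℤ_[p])ˣ, ∀ i j : Fin n, m ≤ i → j < i →
      (A * (C : Matrix (Fin n) (Fin n) ℤ_[p]).map PadicInt.Coe.ringHom) i j = 0 := by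
  obtain ⟨k, hk, hmax⟩ := (Finset.Iic m).exists_max_image (fun j ↦ ‖A m j‖) ⟨m, by simp⟩
  rw [Finset.mem_Iic] at hk
  have hmax' (j : Fin n) (hj : j ≤ m) : ‖A m j‖ ≤ ‖A m k‖ := hmax j (by simpa using hj)
  have hle (j : Fin n) (hj : j ≤ m) : Equiv.swap k m j ≤ m := by
    rw [Equiv.swap_apply_def]
    split_ifs <;> simp_all
  let c : Fin n → ℤ_[p] := fun j ↦
    if h : j < m then ⟨A m (Equiv.swap k m j) / A m k, by
      rw [norm_div]
      exact div_le_one_of_le₀ (hmax' _ (hle j h.le)) (norm_nonneg _)⟩ else 0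
  have hc : vecMulVec (Pi.single m 1) c * vecMulVec (Pi.single m 1) c = 0 := by
    rw [vecMulVec_mul_vecMulVec]
    simp [c]
  let E : (Matrix (Fin n) (Fin n) ℤ_[p])ˣ :=
    ⟨1 - vecMulVec (Pi.single m 1) c, 1 + vecMulVec (Pi.single m 1) c,
      by rw [sub_mul, mul_add, mul_add, hc]; simp, by rw [add_mul, mul_sub, mul_sub, hc]; simp⟩
  refine ⟨GeneralLinearGroup.swap ℤ_[p] k m * E, fun i j hi hj ↦ ?_⟩
  have key : (A * ((GeneralLinearGroup.swap ℤ_[p] k m * E : (Matrix (Fin n) (Fin n) ℤ_[p])ˣ) :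
      Matrix (Fin n) (Fin n) ℤ_[p]).map PadicInt.Coe.ringHom) i j =
      A i (Equiv.swap k m j) - A i k * c j := by
    have hE : (E : Matrix (Fin n) (Fin n) ℤ_[p]) = 1 - vecMulVec (Pi.single m 1) c := rfl
    have hs (j : Fin n) : (A * swap ℚ_[p] k m) i j = A i (Equiv.swap k m j) := by
      simp [swap, PEquiv.mul_toMatrix_toPEquiv]
    have hmap : (vecMulVec (Pi.single m 1) c).map (PadicInt.Coe.ringHom (p := p)) =
        vecMulVec (Pi.single m 1) (fun j ↦ (c j : ℚ_[p])) := by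
      ext a b
      by_cases h : a = m
      · simp only [map_apply, vecMulVec_apply, h, Pi.single_eq_same, one_mul]
        rfl
      · simp [vecMulVec_apply, h]
    have hS : ((GeneralLinearGroup.swap ℤ_[p] k m : GL (Fin n) ℤ_[p]) :
        Matrix (Fin n) (Fin n) ℤ_[p]) = swap ℤ_[p] k m := rfl
    rw [Units.val_mul, Matrix.map_mul, hS, hE, map_swap, ← mul_assoc,
      Matrix.map_sub _ (map_sub _), hmap, Matrix.map_one _ (map_zero _) (map_one _), mul_sub,
      mul_one, mul_vecMulVec, Matrix.sub_apply, hs, vecMulVec_apply, mulVec_single_one, col_apply, hs,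
      Equiv.swap_apply_right]
  rw [key]
  rcases hi.eq_or_lt with rfl | hi
  · have : (c j : ℚ_[p]) = A m (Equiv.swap k m j) / A m k := by simp [c, hj]
    rw [this]
    by_cases h0 : A m k = 0
    · have := hmax' _ (hle j hj.le)
      simp_all
    · field_simp
      simp
  · have hki := hA i k hi (hk.trans_lt hi)
    rw [hki, zero_mul, sub_zero]
    refine hA i _ hi ?_
    rcases le_or_gt j m with h | h
    · exact (hle j h).trans_lt hi
    · rwa [Equiv.swap_apply_of_ne_of_ne (hk.trans_lt h).ne' h.ne']

/-- Every square matrix over `ℚ_[p]` becomes upper triangular after right multiplication by an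
invertible matrix over `ℤ_[p]`. -/
theorem Padic.exists_unit_matrix_mul_isUpperTriangular {p : ℕ} [Fact p.Prime] {n : ℕ}
    (A : Matrix (Fin n) (Fin n) ℚ_[p]) :
    ∃ C : (Matrix (Fin n) (Fin n) ℤ_[p])ˣ, ∀ i j : Fin n, j < i →
      (A * (C : Matrix (Fin n) (Fin n) ℤ_[p]).map PadicInt.Coe.ringHom) i j = 0 := by
  suffices h : ∀ k ≤ n, ∃ C : (Matrix (Fin n) (Fin n) ℤ_[p])ˣ, ∀ i j : Fin n, k ≤ i → j < i →
      (A * (C : Matrix (Fin n) (Fin n) ℤ_[p]).map PadicInt.Coe.ringHom) i j = 0 by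
    obtain ⟨C, hC⟩ := h 0 n.zero_le
    exact ⟨C, fun i j ↦ hC i j (Nat.zero_le _)⟩
  intro k hk
  induction hk using Nat.decreasingInduction with
  | self => exact ⟨1, fun i j hi ↦ absurd i.isLt hi.not_gt⟩
  | of_succ k hk ih =>
    obtain ⟨C, hC⟩ := ih
    obtain ⟨D, hD⟩ := exists_unit_matrix_mul_row_eq_zero _ ⟨k, hk⟩ fun i j hi ↦ hC i j hi
    refine ⟨C * D, fun i j hi hj ↦ ?_⟩
    rw [Units.val_mul, Matrix.map_mul, ← mul_assoc]
    exact hD i j hi hj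

/-- Iwasawa-type decomposition: `GL_n(ℚ_p) = B(ℚ_p) · GL_n(ℤ_p)`, i.e. every
invertible matrix over `ℚ_p` is a product of an invertible upper triangular matrix
and a matrix in `GL_n(ℤ_p)` (all entries of the matrix and of its inverse have
`p`-adic norm at most `1`). -/
theorem GL_eq_borel_mul_GLZp (p : ℕ) [Fact p.Prime] (n : ℕ) (hn : 1 ≤ n)
    (A : (Matrix (Fin n) (Fin n) ℚ_[p])ˣ) :
    ∃ B C : (Matrix (Fin n) (Fin n) ℚ_[p])ˣ,
      A = B * C ∧
      (∀ i j : Fin n, j < i → (B : Matrix (Fin n) (Fin n) ℚ_[p]) i j = 0) ∧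
      (∀ i j : Fin n, ‖(C : Matrix (Fin n) (Fin n) ℚ_[p]) i j‖ ≤ 1) ∧
      (∀ i j : Fin n, ‖((C⁻¹ : (Matrix (Fin n) (Fin n) ℚ_[p])ˣ) : Matrix (Fin n) (Fin n) ℚ_[p]) i j‖ ≤ 1) := by
  obtain ⟨D, hD⟩ := Padic.exists_unit_matrix_mul_isUpperTriangular
    (A : Matrix (Fin n) (Fin n) ℚ_[p])
  let C := Units.map (PadicInt.Coe.ringHom (p := p)).mapMatrix.toMonoidHom D
  exact ⟨A * C, C⁻¹, by simp, hD, fun i j ↦ (D⁻¹.val i j).2,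
    fun i j ↦ by rw [inv_inv]; exact (D.val i j).2⟩
end

section
/- (Siegel's formula.) Let R be a commutative ring, n ≥ 1 an integer, and y, z ∈ R elements with (n!) · y = z (e.g. y = z / n! when n! is invertible in R). Then z = Σ_{k=0}^{n−1} (−1)^{n−k−1} · C(n−1, k) · ((y + k)^n − k^n), where C(n−1, k) denotes the binomial coefficient and the integers (−1)^{n−k−1}, C(n−1,k), k are mapped into R via the canonical ring homomorphism ℤ → R. In particular, if n! is invertible in R, every element of R is a ℤ-linear combination of n-th powers of elements of R. -/
/-- The `m`-th forward difference of `x ↦ (y + x) ^ (m + 1) - x ^ (m + 1)` is the constant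
`(m + 1)! * y`. -/
theorem fwdDiff_iter_add_pow_sub_pow {R : Type*} [CommRing R] (m : ℕ) (y x : R) :
    (fwdDiff 1)^[m] (fun r : R ↦ (y + r) ^ (m + 1) - r ^ (m + 1)) x =
      ((m + 1).factorial : R) * y := by
  have hexp : (fun r : R ↦ (y + r) ^ (m + 1) - r ^ (m + 1)) =
      ∑ j ∈ Finset.range (m + 1),
        (((m + 1).choose j : R) * y ^ (m + 1 - j)) • fun r : R ↦ r ^ j := by
    ext r
    rw [add_comm y r, add_pow, Finset.sum_range_succ, Finset.sum_apply]
    simp only [Nat.sub_self, pow_zero, mul_one, Nat.choose_self, Nat.cast_one,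
      add_sub_cancel_right, Pi.smul_apply, smul_eq_mul]
    exact Finset.sum_congr rfl fun j _ ↦ by ring
  rw [hexp, fwdDiff_iter_finsetSum, Finset.sum_range_succ, Finset.sum_eq_zero fun j hj ↦ by
    rw [fwdDiff_iter_const_smul, fwdDiff_iter_pow_eq_zero_of_lt (Finset.mem_range.mp hj),
      smul_zero], fwdDiff_iter_const_smul, fwdDiff_iter_eq_factorial]
  simp [Nat.factorial_succ]
  ring

/-- Siegel's formula: in a commutative ring `R`, if `(n!) · y = z`, then
`z = Σ_{k=0}^{n-1} (-1)^(n-k-1) · C(n-1,k) · ((y + k)^n - k^n)`. In particular, if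
`n!` is invertible in `R`, every element of `R` is a `ℤ`-linear combination of `n`-th
powers. -/
theorem siegel_formula (R : Type*) [CommRing R] (n : ℕ) (hn : 1 ≤ n) (y z : R)
    (h : (n.factorial : R) * y = z) :
    z = ∑ k ∈ Finset.range n,
      (-1 : R) ^ (n - k - 1) * (Nat.choose (n - 1) k : R) *
        ((y + (k : R)) ^ n - (k : R) ^ n) := by
  obtain ⟨m, rfl⟩ := Nat.exists_eq_add_of_le' hn
  rw [← h, ← fwdDiff_iter_add_pow_sub_pow m y 0, fwdDiff_iter_eq_sum_shift]
  refine Finset.sum_congr rfl fun k _ ↦ ?_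
  rw [show m + 1 - k - 1 = m - k by lia]
  simp [zsmul_eq_mul]
end

section
/- Let R be a commutative ring that is a ℚ-algebra, let n ≥ 1 be an integer, and let f : R → R be an additive group homomorphism satisfying f(t^n · u) = t^n · f(u) for all t, u ∈ R. Then f is R-linear: f(t · u) = t · f(u) for all t, u ∈ R, and hence f(x) = x · f(1) for all x ∈ R. -/
open Polynomial in
/-- There are rational weights on the nodes `0, …, n` which extract the linear coefficient
of every polynomial of degree at most `n` from its values at the nodes. -/
lemma exists_weights_sum_pow_eq (n : ℕ) :
    ∃ w : ℕ → ℚ, ∀ i ≤ n,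
      ∑ k ∈ Finset.range (n + 1), w k * (k : ℚ) ^ i = if i = 1 then 1 else 0 := by
  refine ⟨fun k => (Lagrange.basis (Finset.range (n + 1)) (fun k : ℕ => (k : ℚ)) k).coeff 1,
    fun i hi => ?_⟩
  have h := Lagrange.eq_interpolate (s := Finset.range (n + 1)) (v := fun k : ℕ => (k : ℚ))
    (f := (X : ℚ[X]) ^ i) (Nat.cast_injective.injOn)
    (by rw [degree_X_pow, Finset.card_range]; exact_mod_cast Nat.lt_succ_of_le hi)
  have h1 := congrArg (fun p : ℚ[X] => p.coeff 1) h
  simp only [Lagrange.interpolate_apply, finsetSum_coeff, coeff_C_mul, eval_pow, eval_X,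
    coeff_X_pow] at h1
  simp only [mul_comm _ ((_ : ℚ) ^ i), ← h1, eq_comm]

/-- In a commutative `ℚ`-algebra, `n • t` is a fixed `ℚ`-linear combination of the `n`-th powers
of `k t + 1` for `k = 0, …, n`. -/
lemma exists_weights_sum_mul_add_one_pow_eq {R : Type*} [CommRing R] [Algebra ℚ R]
    (n : ℕ) (hn : 1 ≤ n) :
    ∃ w : ℕ → ℚ, ∀ t : R, ∑ k ∈ Finset.range (n + 1), w k • (k * t + 1) ^ n = n * t := by
  obtain ⟨w, hw⟩ := exists_weights_sum_pow_eq n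
  refine ⟨w, fun t => ?_⟩
  calc ∑ k ∈ Finset.range (n + 1), w k • ((k : R) * t + 1) ^ n
      = ∑ i ∈ Finset.range (n + 1),
          (∑ k ∈ Finset.range (n + 1), w k * (k : ℚ) ^ i) • (t ^ i * (n.choose i : R)) := by
        simp only [add_pow, Finset.smul_sum, Finset.sum_smul]
        rw [Finset.sum_comm]
        refine Finset.sum_congr rfl fun i _ => Finset.sum_congr rfl fun k _ => ?_
        simp only [Algebra.smul_def, map_mul, map_pow, map_natCast]
        ring
    _ = ∑ i ∈ Finset.range (n + 1), if i = 1 then t ^ i * (n.choose i : R) else 0 := by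
        refine Finset.sum_congr rfl fun i hi => ?_
        rw [hw i (Nat.lt_succ_iff.mp (Finset.mem_range.mp hi)), ite_smul, one_smul, zero_smul]
    _ = n * t := by
        rw [Finset.sum_ite_eq', if_pos (Finset.mem_range.mpr (by omega)), pow_one,
          Nat.choose_one_right, mul_comm]

/-- Let `R` be a commutative `ℚ`-algebra and `n ≥ 1`. Any additive endomorphism `f`
of `R` satisfying `f(t^n · u) = t^n · f(u)` for all `t, u ∈ R` is `R`-linear, and
hence `f(x) = x · f(1)` for all `x`. -/
theorem addHom_power_equivariant_linear
    (R : Type*) [CommRing R] [Algebra ℚ R] (n : ℕ) (hn : 1 ≤ n)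
    (f : R →+ R) (hf : ∀ t u : R, f (t ^ n * u) = t ^ n * f u) :
    (∀ t u : R, f (t * u) = t * f u) ∧ ∀ x : R, f x = x * f 1 := by
  have key : ∀ t u : R, f (t * u) = t * f u := by
    intro t u
    obtain ⟨w, hw⟩ := exists_weights_sum_mul_add_one_pow_eq (R := R) n hn
    have h : f (n * t * u) = n * t * f u := by
      rw [← hw t]
      simp only [Finset.sum_mul, map_sum, smul_mul_assoc, map_rat_smul, hf]
    have h' : (n : ℚ) • f (t * u) = (n : ℚ) • (t * f u) := by
      rw [← map_rat_smul f]
      simpa only [Algebra.smul_def, map_natCast, mul_assoc] using h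
    exact smul_right_injective R (Nat.cast_ne_zero.mpr (by omega : n ≠ 0)) h'
  exact ⟨key, fun x => by simpa using key x 1⟩
end
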